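/- Let r and r' be rank sequences for n with r'_i ≤ r_i for all i ∈ Z/lZ. Then every point of Comp(n) whose rank sequence is r' lies in the Zariski closure of the GL(n)-orbit of any point of Comp(n) whose rank sequence is r; that is, Comp^0(n,r') is contained in the Zariski closure of Comp^0(n,r). -/

import Mathlib

/-!  Circular complexes framework: `K` algebraically closed, char 0;
`n : ZMod l → ℕ` a tuple of positive integers. -/

open MvPolynomial in
/-- The Zariski topology on the affine space `ι → K`: the topology generated by the
basic open sets `{x | p(x) ≠ 0}` for polynomials `p`. -/
def zariskiTopology (ι K : Type) [CommSemiring K] : TopologicalSpace (ι → K) :=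
  .generateFrom { U | ∃ p : MvPolynomial ι K, U = { x | eval x p ≠ 0 } }

/-- The ambient affine space `∏_{i ∈ ℤ/lℤ} Mat_{n_{i+1} × n_i}(K)` in which the
variety of circular complexes lives. -/
abbrev CompSpace (K : Type) [Field K] {l : ℕ} (n : ZMod l → ℕ) : Type :=
  ∀ i : ZMod l, Matrix (Fin (n (i + 1))) (Fin (n i)) K

/-- Coordinates on `CompSpace K n`. -/
def compCoord {K : Type} [Field K] {l : ℕ} (n : ZMod l → ℕ) :
    CompSpace K n → ((Σ i : ZMod l, Fin (n (i + 1)) × Fin (n i)) → K) :=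
  fun A q => A q.1 q.2.1 q.2.2

/-- The Zariski topology on `CompSpace K n`, induced from the Zariski topology on
coordinates. -/
def compTopology (K : Type) [Field K] {l : ℕ} (n : ZMod l → ℕ) :
    TopologicalSpace (CompSpace K n) :=
  (zariskiTopology _ K).induced (compCoord n)

/-- `Comp(𝐧)`, the variety of circular complexes: tuples `(A_i)` with
`A_{i+1} A_i = 0` for all `i ∈ ℤ/lℤ`. -/
def Comp (K : Type) [Field K] {l : ℕ} (n : ZMod l → ℕ) : Set (CompSpace K n) :=
  { A | ∀ i : ZMod l, A (i + 1) * A i = 0 }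

/-- `Comp(𝐧,𝐫)`: circular complexes with `rank A_i ≤ r_i` for all `i`. -/
def CompR (K : Type) [Field K] {l : ℕ} (n r : ZMod l → ℕ) : Set (CompSpace K n) :=
  { A ∈ Comp K n | ∀ i, (A i).rank ≤ r i }

/-- `Comp⁰(𝐧,𝐫)`: circular complexes with `rank A_i = r_i` for all `i`. -/
def Comp0 (K : Type) [Field K] {l : ℕ} (n r : ZMod l → ℕ) : Set (CompSpace K n) :=
  { A ∈ Comp K n | ∀ i, (A i).rank = r i }

/-- `r` is a rank sequence for `n`: it is realized by some circular complex. -/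
def IsRankSeq (K : Type) [Field K] {l : ℕ} (n r : ZMod l → ℕ) : Prop :=
  ∃ A ∈ Comp K n, ∀ i, (A i).rank = r i

open Filter Topology in
/-- A line through `x` tends to `x` along the cofinite filter, in the Zariski
topology. -/
theorem tendsto_line_zariskiTopology {ι K : Type} [Field K] (x y : ι → K) :
    letI := zariskiTopology ι K
    Tendsto (fun t : K => x + t • y) cofinite (𝓝 x) := by
  let := zariskiTopology ι K
  have h_nhds : 𝓝 x = _ := TopologicalSpace.nhds_generateFrom
  rw [h_nhds]
  simp only [tendsto_iInf, tendsto_principal]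
  rintro _ ⟨hx, p, rfl⟩
  let P : Polynomial K :=
    MvPolynomial.aeval (fun i => Polynomial.C (x i) + Polynomial.X * Polynomial.C (y i)) p
  have hP : ∀ t, P.eval t = MvPolynomial.eval (x + t • y) p := by
    intro t
    subst P
    clear hx
    induction p using MvPolynomial.induction_on with
    | C a => simp
    | add p q hp hq => simp only [map_add, Polynomial.eval_add, hp, hq]
    | mul_X p i hp => simp only [map_mul, Polynomial.eval_mul, hp]; simp [mul_comm t]
  have hP0 : P ≠ 0 := by
    intro h
    have := hP 0
    simp only [h, Polynomial.eval_zero, zero_smul, add_zero] at this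
    exact hx this.symm
  have hfin : {t | ¬ P.eval t ≠ 0}.Finite :=
    (Polynomial.finite_setOfPred_isRoot hP0).subset fun t ht => not_not.mp ht
  filter_upwards [hfin.eventually_cofinite_notMem] with t ht
  simpa [hP] using ht

open Filter Topology in
/-- If the line through `A` in direction `B` lies in `S` away from `A`, then `A` lies in the
Zariski closure of `S`. -/
theorem mem_closure_compTopology_of_line {K : Type} [Field K] [Infinite K] {l : ℕ}
    {n : ZMod l → ℕ} {S : Set (CompSpace K n)} (A B : CompSpace K n)
    (h : ∀ t : K, t ≠ 0 → A + t • B ∈ S) :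
    letI := compTopology K n
    A ∈ closure S := by
  let := zariskiTopology (Σ i : ZMod l, Fin (n (i + 1)) × Fin (n i)) K
  let : TopologicalSpace (CompSpace K n) := compTopology K n
  have hlim : Tendsto (fun t : K => A + t • B) cofinite (𝓝 A) := by
    have hind : IsInducing (compCoord n : CompSpace K n → _) := ⟨rfl⟩
    rw [hind.tendsto_nhds_iff]
    exact tendsto_line_zariskiTopology (compCoord n A) (compCoord n B)
  refine mem_closure_of_tendsto hlim ?_
  filter_upwards [(Set.finite_singleton (0 : K)).eventually_cofinite_notMem] with t ht
  exact h t ht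

/-- For composable linear maps with zero composition, the middle homology contains any number of
independent classes up to its dimension, together with a dual family of functionals. -/
theorem LinearMap.exists_homology_dual_family {K U V W : Type*} [Field K] [AddCommGroup U]
    [Module K U] [AddCommGroup V] [Module K V] [AddCommGroup W] [Module K W]
    [FiniteDimensional K V] (f : U →ₗ[K] V) (g : V →ₗ[K] W) (hgf : g ∘ₗ f = 0) {m : ℕ}
    (hm : Module.finrank K (range f) + Module.finrank K (range g) + m ≤ Module.finrank K V) :
    ∃ (v : Fin m → V) (φ : V →ₗ[K] (Fin m → K)),
      (∀ k, g (v k) = 0) ∧ φ ∘ₗ f = 0 ∧ ∀ k, φ (v k) = Pi.single k 1 := by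
  have hle : range f ≤ ker g := range_le_ker_iff.mpr hgf
  let u : ker g →ₗ[K] V ⧸ range f := (range f).mkQ ∘ₗ (ker g).subtype
  have hker : Module.finrank K (ker u) = Module.finrank K (range f) := by
    have : ker u = (range f).comap (ker g).subtype := by simp [u, ker_comp]
    rw [this]
    exact (Submodule.comapSubtypeEquivOfLe hle).finrank_eq
  have hu := finrank_range_add_finrank_ker u
  have hg := finrank_range_add_finrank_ker g
  obtain ⟨w, hw⟩ := exists_linearIndependent_of_le_finrank
    (show m ≤ Module.finrank K (range u) by omega)
  choose v hv using fun k => (w k).2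
  have hw' : LinearIndependent K fun k => (w k : V ⧸ range f) :=
    hw.map' (range u).subtype (Submodule.ker_subtype _)
  obtain ⟨ψ, hψ⟩ := exists_leftInverse_of_injective
    (Fintype.linearCombination K fun k => (w k : V ⧸ range f))
    (ker_eq_bot.mpr (hw'.fintypeLinearCombination_injective))
  refine ⟨fun k => v k, ψ ∘ₗ (range f).mkQ, fun k => (v k).2, ?_, fun k => ?_⟩
  · rw [comp_assoc, range_mkQ_comp, comp_zero]
  · have h := congr($hψ (Pi.single k 1))
    simp only [comp_apply, Fintype.linearCombination_apply_single, one_smul, id_apply] at h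
    rw [← h, ← hv k]
    rfl

open scoped Matrix in
/-- Matrix form of `LinearMap.exists_homology_dual_family`, with the family split in two. -/
theorem Matrix.exists_homology_dual_matrices {K : Type*} [Field K] {p q n : ℕ}
    (a : Matrix (Fin n) (Fin p) K) (b : Matrix (Fin q) (Fin n) K) (hba : b * a = 0) {c d : ℕ}
    (h : a.rank + b.rank + (c + d) ≤ n) :
    ∃ (P : Matrix (Fin n) (Fin c) K) (Y : Matrix (Fin c) (Fin n) K)
      (X : Matrix (Fin n) (Fin d) K) (Q : Matrix (Fin d) (Fin n) K),
      Y * P = 1 ∧ Q * X = 1 ∧ Q * P = 0 ∧ b * P = 0 ∧ b * X = 0 ∧ Y * a = 0 ∧ Q * a = 0 := by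
  obtain ⟨v, φ, hv, hφ, hφv⟩ := LinearMap.exists_homology_dual_family a.mulVecLin b.mulVecLin
    (by rw [← Matrix.mulVecLin_mul, hba, Matrix.mulVecLin_zero]) (m := c + d)
    (by simpa [Matrix.rank] using h)
  let H : Matrix (Fin n) (Fin (c + d)) K := Matrix.of fun j k => v k j
  let F : Matrix (Fin (c + d)) (Fin n) K := LinearMap.toMatrix' φ
  have hF : ∀ x, F *ᵥ x = φ x := fun x => by
    rw [← Matrix.toLin'_apply, Matrix.toLin'_toMatrix']
  have hFH : F * H = 1 := by
    ext i k
    have : (F * H) i k = (F *ᵥ v k) i := rfl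
    rw [this, hF, hφv, Matrix.one_apply, Pi.single_apply]
  have hbH : b * H = 0 := by
    ext i k
    exact congrFun (hv k) i
  have hFa : F * a = 0 := by
    apply Matrix.toLin'.injective
    rw [Matrix.toLin'_mul, Matrix.toLin'_toMatrix', map_zero]
    exact hφ
  refine ⟨H.submatrix id (Fin.castAdd d), F.submatrix (Fin.castAdd d) id,
    H.submatrix id (Fin.natAdd c), F.submatrix (Fin.natAdd c) id, ?_, ?_, ?_, ?_, ?_, ?_, ?_⟩
  · ext i k
    exact congr($hFH (Fin.castAdd d i) (Fin.castAdd d k)).trans (by simp [Matrix.one_apply])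
  · ext i k
    exact congr($hFH (Fin.natAdd c i) (Fin.natAdd c k)).trans (by simp [Matrix.one_apply])
  · ext i k
    have hik : Fin.natAdd c i ≠ Fin.castAdd d k := by
      simp only [ne_eq, Fin.ext_iff, Fin.val_natAdd, Fin.val_castAdd]
      omega
    exact congr($hFH (Fin.natAdd c i) (Fin.castAdd d k)).trans (Matrix.one_apply_ne hik)
  · ext i k
    exact congr($hbH i (Fin.castAdd d k))
  · ext i k
    exact congr($hbH i (Fin.natAdd c k))
  · ext i k
    exact congr($hFa (Fin.castAdd d i) k)
  · ext i k
    exact congr($hFa (Fin.natAdd c i) k)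

open scoped Matrix in
/-- Adding to `A` a map of rank `d` transversal to it raises the rank by `d`. -/
theorem Matrix.rank_add_smul_mul {K : Type*} [Field K] {m n d : ℕ}
    (A : Matrix (Fin m) (Fin n) K) (P : Matrix (Fin m) (Fin d) K) (Q : Matrix (Fin d) (Fin n) K)
    (X : Matrix (Fin n) (Fin d) K) (Y : Matrix (Fin d) (Fin m) K) (hQX : Q * X = 1)
    (hAX : A * X = 0) (hYP : Y * P = 1) (hYA : Y * A = 0) {t : K} (ht : t ≠ 0) :
    (A + t • (P * Q)).rank = A.rank + d := by
  have hrange : LinearMap.range (A + t • (P * Q)).mulVecLin =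
      LinearMap.range A.mulVecLin ⊔ LinearMap.range P.mulVecLin := by
    have hmul : ∀ x, (A + t • (P * Q)) *ᵥ x = A *ᵥ x + P *ᵥ (t • Q *ᵥ x) := fun x => by
      rw [Matrix.add_mulVec, Matrix.smul_mulVec, Matrix.mulVec_smul, Matrix.mulVec_mulVec]
    have hP : LinearMap.range P.mulVecLin ≤ LinearMap.range (A + t • (P * Q)).mulVecLin := by
      rintro _ ⟨x, rfl⟩
      refine ⟨X *ᵥ (t⁻¹ • x), ?_⟩
      simp only [Matrix.mulVecLin_apply]
      rw [hmul, Matrix.mulVec_mulVec, Matrix.mulVec_mulVec, hAX, hQX]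
      simp [smul_smul, ht]
    refine le_antisymm ?_ (sup_le ?_ hP)
    · rintro _ ⟨x, rfl⟩
      rw [Matrix.mulVecLin_apply, hmul]
      exact Submodule.add_mem_sup ⟨x, rfl⟩ ⟨_, rfl⟩
    · rintro _ ⟨x, rfl⟩
      have := sub_mem (LinearMap.mem_range_self (A + t • (P * Q)).mulVecLin x)
        (hP ⟨t • Q *ᵥ x, rfl⟩)
      simpa only [Matrix.mulVecLin_apply, hmul, add_sub_cancel_right] using this
  have hinf : LinearMap.range A.mulVecLin ⊓ LinearMap.range P.mulVecLin = ⊥ := by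
    rw [eq_bot_iff]
    rintro _ ⟨⟨x, rfl⟩, z, hz⟩
    simp only [Matrix.mulVecLin_apply] at hz
    have h0 : z = 0 := by
      have := congr(Y *ᵥ $hz)
      simpa [Matrix.mulVec_mulVec, hYP, hYA] using this
    simp [← hz, h0]
  have hPinj : Function.Injective P.mulVecLin := fun x y hxy => by
    have := congr(Y *ᵥ $hxy)
    simpa [Matrix.mulVec_mulVec, hYP] using this
  have h := Submodule.finrank_sup_add_finrank_inf_eq (LinearMap.range A.mulVecLin)
    (LinearMap.range P.mulVecLin)
  rw [hinf, finrank_bot, add_zero, LinearMap.finrank_range_of_inj hPinj, Module.finrank_fin_fun]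
    at h
  rw [Matrix.rank, hrange, h, Matrix.rank]

/-- Consecutive terms of a rank sequence satisfy `r_i + r_{i+1} ≤ n_{i+1}`. -/
theorem IsRankSeq.add_le {K : Type} [Field K] {l : ℕ} {n r : ZMod l → ℕ}
    (h : IsRankSeq K n r) (i : ZMod l) : r i + r (i + 1) ≤ n (i + 1) := by
  obtain ⟨A, hA, hr⟩ := h
  have hle : LinearMap.range (A i).mulVecLin ≤ LinearMap.ker (A (i + 1)).mulVecLin := by
    rw [LinearMap.range_le_ker_iff, ← Matrix.mulVecLin_mul, hA i, Matrix.mulVecLin_zero]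
  have h1 := Submodule.finrank_mono hle
  have h2 := LinearMap.finrank_range_add_finrank_ker (A (i + 1)).mulVecLin
  rw [Module.finrank_fin_fun] at h2
  rw [← hr i, ← hr (i + 1), Matrix.rank, Matrix.rank]
  omega

/-- A dependent family on the nodes `i + 1` of the cycle is a family on all nodes. -/
theorem ZMod.exists_forall_add_one_eq {l : ℕ} {T : ZMod l → Type*} (f : ∀ i, T (i + 1)) :
    ∃ g : ∀ i, T i, ∀ i, g (i + 1) = f i :=
  ⟨Equiv.piCongrLeft T (Equiv.addRight 1) f,
    Equiv.piCongrLeft_apply_apply T (Equiv.addRight 1) f⟩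

/-- **Statement 9.** If `r`, `r'` are rank sequences for `n` with `r'_i ≤ r_i` for all
`i`, then every point of `Comp(n)` with rank sequence `r'` lies in the Zariski closure
of the set `Comp⁰(n,r)` of points with rank sequence `r` (a single `GL(n)`-orbit). -/
theorem Comp0_subset_closure_Comp0 {K : Type} [Field K] [IsAlgClosed K] [CharZero K]
    {l : ℕ} [NeZero l] (n : ZMod l → ℕ) (hn : ∀ i, 0 < n i)
    (r r' : ZMod l → ℕ) (hr : IsRankSeq K n r) (hr' : IsRankSeq K n r')
    (hle : ∀ i, r' i ≤ r i) :
    letI := compTopology K n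
    Comp0 K n r' ⊆ closure (Comp0 K n r) := by
  intro A ⟨hA, hrA⟩
  obtain ⟨d, hd⟩ : ∃ d : ZMod l → ℕ, ∀ i, r' i + d i = r i :=
    ⟨fun i => r i - r' i, fun i => Nat.add_sub_cancel' (hle i)⟩
  have hnode := fun i => Matrix.exists_homology_dual_matrices (A i) (A (i + 1)) (hA i)
    (c := d i) (d := d (i + 1)) (by
      have h1 := hr.add_le i
      have h2 := hd i
      have h3 := hd (i + 1)
      rw [hrA, hrA]
      omega)
  choose P Y X₁ Q₁ hYP hQX₁ hQP₁ hAP hAX₁ hYA hQA₁ using hnode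
  obtain ⟨X, hX⟩ := ZMod.exists_forall_add_one_eq
    (T := fun i => Matrix (Fin (n i)) (Fin (d i)) K) X₁
  obtain ⟨Q, hQ⟩ := ZMod.exists_forall_add_one_eq
    (T := fun i => Matrix (Fin (d i)) (Fin (n i)) K) Q₁
  simp only [← hX, ← hQ] at hQX₁ hQP₁ hAX₁ hQA₁
  have hQX : ∀ i, Q i * X i = 1 := fun i => by
    obtain ⟨j, rfl⟩ := (Equiv.addRight (1 : ZMod l)).surjective i
    exact hQX₁ j
  have hAX : ∀ i, A i * X i = 0 := fun i => by
    obtain ⟨j, rfl⟩ := (Equiv.addRight (1 : ZMod l)).surjective i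
    exact hAX₁ j
  refine mem_closure_compTopology_of_line A (fun i => P i * Q i)
    fun t ht => ⟨fun i => ?_, fun i => ?_⟩
  · have h1 : A (i + 1) * (P i * Q i) = 0 := by rw [← Matrix.mul_assoc, hAP, Matrix.zero_mul]
    have h2 : P (i + 1) * Q (i + 1) * A i = 0 := by
      rw [Matrix.mul_assoc, hQA₁, Matrix.mul_zero]
    have h3 : P (i + 1) * Q (i + 1) * (P i * Q i) = 0 := by
      rw [Matrix.mul_assoc, ← Matrix.mul_assoc (Q (i + 1)), hQP₁, Matrix.zero_mul,
        Matrix.mul_zero]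
    simp only [Pi.add_apply, Pi.smul_apply]
    rw [Matrix.add_mul, Matrix.mul_add, Matrix.mul_add, hA i, Matrix.mul_smul, Matrix.smul_mul,
      Matrix.smul_mul, Matrix.mul_smul, h1, h2, h3]
    simp
  · rw [← hd i, ← hrA i]
    exact Matrix.rank_add_smul_mul (A i) (P i) (Q i) (X i) (Y i) (hQX i) (hAX i) (hYP i) (hYA i) ht
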